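/- The reduction-mod-2 homomorphism R : SL_n(ℤ) → SL_n(ℤ/2ℤ), restricted to 𝒲ₙ(2), is a surjective group homomorphism onto the group Pₙ of permutation matrices over ℤ/2ℤ, and its kernel is Γₙ(2); in other words there is a short exact sequence 1 → Γₙ(2) → 𝒲ₙ(2) → Pₙ → 1, where Pₙ is isomorphic to the symmetric group on n letters. -/

import Mathlib

/-- The set 𝒲ₙ(2) of matrices `A ∈ SL_n(ℤ)` such that the pre-dot product
(entrywise product) of any two distinct rows of `A` lies in `(2ℤ)ⁿ`. -/
def Wn (n : ℕ) : Set (Matrix.SpecialLinearGroup (Fin n) ℤ) :=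
  {A | ∀ i j : Fin n, i ≠ j → ∀ s : Fin n, (2 : ℤ) ∣ A.1 i s * A.1 j s}

/-- The reduction-mod-2 homomorphism `R : SL_n(ℤ) → SL_n(ℤ/2ℤ)`. -/
def Rmod2 (n : ℕ) :
    Matrix.SpecialLinearGroup (Fin n) ℤ →* Matrix.SpecialLinearGroup (Fin n) (ZMod 2) :=
  Matrix.SpecialLinearGroup.map (Int.castRingHom (ZMod 2))

/-- The principal congruence subgroup `Γₙ(2)`, the kernel of the reduction
homomorphism `SL_n(ℤ) → SL_n(ℤ/2ℤ)`. -/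
def Gamma (n : ℕ) : Subgroup (Matrix.SpecialLinearGroup (Fin n) ℤ) :=
  (Rmod2 n).ker

theorem mem_Wn_iff {n : ℕ} {A : Matrix.SpecialLinearGroup (Fin n) ℤ} :
    A ∈ Wn n ↔ ∀ i j : Fin n, i ≠ j → ∀ s : Fin n,
      ((Rmod2 n) A).1 i s * ((Rmod2 n) A).1 j s = 0 := by
  refine forall_congr' fun i => forall_congr' fun j => forall_congr' fun _ =>
    forall_congr' fun s => ?_
  have h := ZMod.intCast_zmod_eq_zero_iff_dvd (A.1 i s * A.1 j s) 2
  rw [Int.cast_mul] at h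
  exact h.symm

theorem permMatrix_apply_eq_ite {n : ℕ} {R : Type*} [Zero R] [One R]
    (σ : Equiv.Perm (Fin n)) (i j : Fin n) :
    σ.permMatrix R i j = if σ i = j then 1 else 0 := by
  simp [Equiv.Perm.permMatrix, PEquiv.toMatrix_apply, Equiv.toPEquiv_apply, eq_comm]

/-- A matrix over `ℤ/2ℤ` of nonzero determinant whose distinct rows have disjoint supports is a
permutation matrix. -/
theorem exists_eq_permMatrix_of_mul_eq_zero {n : ℕ} {B : Matrix (Fin n) (Fin n) (ZMod 2)}
    (hdet : B.det ≠ 0) (hB : ∀ i j : Fin n, i ≠ j → ∀ s, B i s * B j s = 0) :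
    ∃ σ : Equiv.Perm (Fin n), B = σ.permMatrix (ZMod 2) := by
  have hrow : ∀ i, ∃ j, B i j ≠ 0 := by
    intro i
    by_contra! h
    exact hdet (Matrix.det_eq_zero_of_row_eq_zero i h)
  choose g hg using hrow
  have hinj : Function.Injective g := by
    intro i j hij
    by_contra hne
    exact mul_ne_zero (hg i) (hij ▸ hg j) (hB i j hne (g i))
  refine ⟨Equiv.ofBijective g (Finite.injective_iff_bijective.mp hinj), ?_⟩
  ext i j
  rw [permMatrix_apply_eq_ite, Equiv.ofBijective_apply]
  split_ifs with h
  · exact h ▸ Fin.eq_one_of_ne_zero (B i (g i)) (hg i)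
  · obtain ⟨k, rfl⟩ := Finite.surjective_of_injective hinj j
    have hik : i ≠ k := fun e => h (congrArg g e)
    exact (mul_eq_zero.mp (hB i k hik (g k))).resolve_right (hg k)

theorem permMatrix_mul_apply_eq_zero {n : ℕ} {R : Type*} [MulZeroOneClass R]
    (σ : Equiv.Perm (Fin n)) {i j : Fin n} (hij : i ≠ j) (s : Fin n) :
    σ.permMatrix R i s * σ.permMatrix R j s = 0 := by
  rw [permMatrix_apply_eq_ite, permMatrix_apply_eq_ite]
  split_ifs with h₁ h₂
  · exact absurd (σ.injective (h₁.trans h₂.symm)) hij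
  all_goals simp

theorem permMatrix_injective {n : ℕ} {R : Type*} [MulZeroOneClass R] [Nontrivial R] :
    Function.Injective (fun σ : Equiv.Perm (Fin n) => σ.permMatrix R) := by
  intro σ τ h
  ext1 i
  have h' : σ.permMatrix R i (σ i) = τ.permMatrix R i (σ i) := congrFun (congrFun h i) (σ i)
  rw [permMatrix_apply_eq_ite, permMatrix_apply_eq_ite, if_pos rfl] at h'
  by_contra hne
  rw [if_neg (Ne.symm hne)] at h'
  exact one_ne_zero h'

/-- Every permutation matrix over `ℤ/2ℤ` lifts to `SL_n(ℤ)`: multiply the first row of the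
integral permutation matrix by the sign of the permutation. -/
theorem exists_Rmod2_eq_permMatrix {n : ℕ} (σ : Equiv.Perm (Fin n)) :
    ∃ A, ((Rmod2 n) A).1 = σ.permMatrix (ZMod 2) := by
  cases n with
  | zero => exact ⟨1, Subsingleton.elim _ _⟩
  | succ m =>
    let d : Fin (m + 1) → ℤ := Function.update 1 0 (Equiv.Perm.sign σ : ℤ)
    have hd : ∀ i, ((d i : ℤ) : ZMod 2) = 1 := by
      intro i
      rcases eq_or_ne i 0 with rfl | hi
      · rcases Int.units_eq_one_or (Equiv.Perm.sign σ) with h | h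
        · simp [d, h]
        · simp [d, h]
      · simp [d, hi]
    refine ⟨⟨Matrix.diagonal d * σ.permMatrix ℤ, ?_⟩, ?_⟩
    · rw [Matrix.det_mul, Matrix.det_diagonal, Matrix.det_permutation,
        Finset.prod_update_of_mem (Finset.mem_univ _)]
      rcases Int.units_eq_one_or (Equiv.Perm.sign σ) with h | h <;> simp [h]
    · ext i j
      change (((Matrix.diagonal d * σ.permMatrix ℤ) i j : ℤ) : ZMod 2) = _
      rw [Matrix.diagonal_mul, Int.cast_mul, hd, one_mul, permMatrix_apply_eq_ite,
        permMatrix_apply_eq_ite]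
      split_ifs <;> simp

/-- The reduction-mod-2 homomorphism restricted to `𝒲ₙ(2)` is a surjection onto the set
`Pₙ` of permutation matrices over `ℤ/2ℤ` with kernel `Γₙ(2)`; this gives a short exact
sequence `1 → Γₙ(2) → 𝒲ₙ(2) → Pₙ → 1`, where `Pₙ` is isomorphic to the symmetric group
on `n` letters (the assignment `σ ↦ P_σ` being injective and compatible with products). -/
theorem Wn_short_exact_sequence (n : ℕ) :
    (∀ A ∈ Wn n, ∃ σ : Equiv.Perm (Fin n),
      ((Rmod2 n) A).1 = σ.permMatrix (ZMod 2)) ∧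
    (∀ σ : Equiv.Perm (Fin n), ∃ A ∈ Wn n,
      ((Rmod2 n) A).1 = σ.permMatrix (ZMod 2)) ∧
    (∀ A ∈ Gamma n, A ∈ Wn n) ∧
    (∀ A ∈ Wn n, ((Rmod2 n) A = 1 ↔ A ∈ Gamma n)) ∧
    Function.Injective (fun σ : Equiv.Perm (Fin n) => σ.permMatrix (ZMod 2)) ∧
    (∀ σ τ : Equiv.Perm (Fin n),
      σ.permMatrix (ZMod 2) * τ.permMatrix (ZMod 2) = (τ * σ).permMatrix (ZMod 2)) := by
  refine ⟨fun A hA => ?_, fun σ => ?_, fun A hA => ?_, fun A _ => MonoidHom.mem_ker.symm,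
    permMatrix_injective, fun σ τ => (Matrix.permMatrix_mul τ σ).symm⟩
  · exact exists_eq_permMatrix_of_mul_eq_zero
      (((Rmod2 n) A).2.symm ▸ one_ne_zero) (mem_Wn_iff.mp hA)
  · obtain ⟨A, hA⟩ := exists_Rmod2_eq_permMatrix σ
    exact ⟨A, mem_Wn_iff.mpr fun i j hij s => hA ▸ permMatrix_mul_apply_eq_zero σ hij s, hA⟩
  · have h : ((Rmod2 n) A).1 = (1 : Equiv.Perm (Fin n)).permMatrix (ZMod 2) := by
      rw [MonoidHom.mem_ker.mp hA, Matrix.permMatrix_one]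
      rfl
    exact mem_Wn_iff.mpr fun i j hij s => h ▸ permMatrix_mul_apply_eq_zero 1 hij s
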